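/- Let G be a finite simple graph without isolated vertices. If G is a B-graph (every vertex of G belongs to some maximum stable set), then G is τ-critical (removing any vertex strictly decreases the vertex covering number). -/

import Mathlib

/-- A set of vertices is stable (independent) if no two of its vertices are adjacent. -/
def IsStable {V : Type*} (G : SimpleGraph V) (S : Set V) : Prop :=
  ∀ ⦃u⦄, u ∈ S → ∀ ⦃v⦄, v ∈ S → ¬ G.Adj u v

/-- A set of vertices is a vertex cover if it meets every edge. -/
def IsCover {V : Type*} (G : SimpleGraph V) (C : Set V) : Prop :=
  ∀ ⦃u v⦄, G.Adj u v → u ∈ C ∨ v ∈ C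

/-- The stability number α(G): the maximum size of a stable set. -/
noncomputable def alphaNum {V : Type*} (G : SimpleGraph V) : ℕ :=
  sSup {n | ∃ S : Set V, IsStable G S ∧ S.ncard = n}

/-- The vertex covering number τ(G): the minimum size of a vertex cover. -/
noncomputable def tauNum {V : Type*} (G : SimpleGraph V) : ℕ :=
  sInf {n | ∃ C : Set V, IsCover G C ∧ C.ncard = n}

/-- An inclusionwise maximal stable set. -/
def IsMaximalStable {V : Type*} (G : SimpleGraph V) (S : Set V) : Prop :=
  IsStable G S ∧ ∀ T : Set V, IsStable G T → S ⊆ T → S = T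

/-- The σ_v-cover number: the maximum m such that every vertex belongs to a
maximal stable set with at least m vertices. -/
noncomputable def sigmaV {V : Type*} (G : SimpleGraph V) : ℕ :=
  sSup {m | ∀ v : V, ∃ S : Set V, v ∈ S ∧ IsMaximalStable G S ∧ m ≤ S.ncard}

/-- α_core(G): the intersection of all maximum stable sets of G. -/
def alphaCore {V : Type*} (G : SimpleGraph V) : Set V :=
  {v | ∀ S : Set V, IsStable G S → S.ncard = alphaNum G → v ∈ S}

/-- τ_core(G): the intersection of all minimum vertex covers of G. -/
def tauCore {V : Type*} (G : SimpleGraph V) : Set V :=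
  {v | ∀ C : Set V, IsCover G C → C.ncard = tauNum G → v ∈ C}

theorem IsCover.isStable_compl {V : Type*} {G : SimpleGraph V} {C : Set V} (hC : IsCover G C) :
    IsStable G Cᶜ :=
  fun _ hu _ hv h => (hC h).elim hu hv

theorem IsStable.isCover_compl {V : Type*} {G : SimpleGraph V} {S : Set V} (hS : IsStable G S) :
    IsCover G Sᶜ := by
  intro u v h
  by_contra! hc
  exact hS (not_not.mp hc.1) (not_not.mp hc.2) h

theorem IsStable.ncard_le_alphaNum {V : Type*} [Finite V] {G : SimpleGraph V} {S : Set V}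
    (hS : IsStable G S) : S.ncard ≤ alphaNum G :=
  le_csSup ⟨Nat.card V, by rintro _ ⟨T, -, rfl⟩; exact Set.ncard_le_card T⟩ ⟨S, hS, rfl⟩

theorem IsCover.tauNum_le_ncard {V : Type*} {G : SimpleGraph V} {C : Set V} (hC : IsCover G C) :
    tauNum G ≤ C.ncard :=
  Nat.sInf_le ⟨C, hC, rfl⟩

theorem exists_isCover_ncard_eq_tauNum {V : Type*} (G : SimpleGraph V) :
    ∃ C : Set V, IsCover G C ∧ C.ncard = tauNum G :=
  Nat.sInf_mem (s := {n | ∃ C : Set V, IsCover G C ∧ C.ncard = n})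
    ⟨_, Set.univ, fun _ _ _ => Or.inl trivial, rfl⟩

/-- The complement of a maximum stable set is a minimum vertex cover. -/
theorem ncard_compl_le_tauNum {V : Type*} [Finite V] {G : SimpleGraph V} {S : Set V}
    (hS : S.ncard = alphaNum G) : Sᶜ.ncard ≤ tauNum G := by
  obtain ⟨D, hD, hcard⟩ := exists_isCover_ncard_eq_tauNum G
  have hle := hD.isStable_compl.ncard_le_alphaNum
  have h₁ := Set.ncard_add_ncard_compl S
  have h₂ := Set.ncard_add_ncard_compl D
  omega

/-- Deleting a vertex of a cover leaves a cover of the remaining graph. -/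
theorem IsCover.tauNum_induce_lt {V : Type*} [Finite V] {G : SimpleGraph V} {C : Set V} {v : V}
    (hC : IsCover G C) (hv : v ∈ C) : tauNum (G.induce {u | u ≠ v}) < C.ncard := by
  have hcov : IsCover (G.induce {u | u ≠ v}) (Subtype.val ⁻¹' C) := fun _ _ h => hC h
  refine hcov.tauNum_le_ncard.trans_lt ?_
  rw [← Set.ncard_image_of_injective _ Subtype.val_injective]
  refine Set.ncard_lt_ncard ((Set.ssubset_iff_of_subset (Set.image_preimage_subset _ _)).2
    ⟨v, hv, ?_⟩)
  rintro ⟨u, -, hu⟩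
  exact u.2 hu

/-- A B-graph without isolated vertices is τ-critical. -/
theorem stmt_7 {V : Type*} [Fintype V] (G : SimpleGraph V)
    (hiso : ∀ v : V, ∃ w, G.Adj v w)
    (hB : ∀ v : V, ∃ S : Set V, IsStable G S ∧ S.ncard = alphaNum G ∧ v ∈ S) :
    ∀ v : V, tauNum (G.induce {u | u ≠ v}) < tauNum G := by
  intro v
  obtain ⟨w, hvw⟩ := hiso v
  obtain ⟨S, hS, hcard, hw⟩ := hB w
  exact (hS.isCover_compl.tauNum_induce_lt fun hv => hS hv hw hvw).trans_le
    (ncard_compl_le_tauNum hcard)
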